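/- For every α ∈ (0,1) there exists a constant C_α such that for every integer m ≥ 3, every m×m correlation matrix Σ with S = Σ_{i,j=1}^m |Σ_ij|, and x⁰ ~ N(0, Σ): P( max_{t ∈ 𝕋} | m^{-1} Σ_{i=1}^m 1{x_i⁰ > t} − Φ̄(t) | / √(Φ̄(t)) > C_α · m^{−1} √(S · log m) ) < α, where 𝕋 = [√(log log m), √(5 log m)] ∩ ℕ. -/

import Mathlib

open MeasureTheory ProbabilityTheory Filter

noncomputable section

/-- Standard normal CDF `Φ`. -/
def Phi (t : ℝ) : ℝ := ((gaussianReal 0 1) (Set.Iic t)).toReal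

/-- Standard normal upper tail `Φ̄(t) = 1 − Φ(t)`. -/
def PhiBar (t : ℝ) : ℝ := 1 - Phi t

/-- Standard normal density `φ`. -/
def stdPhi (t : ℝ) : ℝ := Real.exp (-(t ^ 2) / 2) / Real.sqrt (2 * Real.pi)

/-- Positive part `[x]₊`. -/
def posPart' (x : ℝ) : ℝ := max x 0

/-- A correlation matrix: symmetric positive semidefinite with unit diagonal. -/
def IsCorrMatrix {ι : Type*} [Fintype ι] (S : Matrix ι ι ℝ) : Prop :=
  S.PosSemidef ∧ ∀ i, S i i = 1

/-- `X` is a Gaussian random vector with mean `μ` and covariance `S`: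
every linear functional of `X` has the corresponding one-dimensional Gaussian law. -/
def HasLawGaussian {Ω : Type*} [MeasureSpace Ω] {ι : Type*} [Fintype ι]
    (X : Ω → ι → ℝ) (μ : ι → ℝ) (S : Matrix ι ι ℝ) : Prop :=
  (∀ i, Measurable fun ω => X ω i) ∧
  ∀ c : ι → ℝ,
    Measure.map (fun ω => ∑ i, c i * X ω i) volume
      = gaussianReal (∑ i, c i * μ i) (∑ i, ∑ j, c i * S i j * c j).toNNReal

/-- number of exceedances `Σ_i 1{x_i > t}` (as a real number). -/
def exceedCount {ι : Type*} [Fintype ι] (x : ι → ℝ) (t : ℝ) : ℝ :=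
  ∑ i, if t < x i then (1 : ℝ) else 0

/-- the quantity inside the supremum defining `π̂_θ(x; c)`. -/
def piHatTerm {ι : Type*} [Fintype ι] (θ c : ℝ) (x : ι → ℝ) (t : ℝ) : ℝ :=
  ((Fintype.card ι : ℝ)⁻¹ * exceedCount x t - PhiBar t - c * PhiBar t ^ θ) / (1 - PhiBar t)

/-- the estimator `π̂_θ(x; c) = sup_{t>0} [...]`. -/
def piHat {ι : Type*} [Fintype ι] (θ c : ℝ) (x : ι → ℝ) : ℝ :=
  sSup {y : ℝ | ∃ t : ℝ, 0 < t ∧ y = piHatTerm θ c x t}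

/-- the quantity inside the supremum defining `V_{n,θ}(x⁰)`. -/
def VTerm {ι : Type*} [Fintype ι] (θ : ℝ) (x : ι → ℝ) (t : ℝ) : ℝ :=
  |(Fintype.card ι : ℝ)⁻¹ * exceedCount x t - PhiBar t| / PhiBar t ^ θ

/-- the statistic `V_{n,θ}(x⁰) = sup_{t>0} |...| / Φ̄(t)^θ`. -/
def Vstat {ι : Type*} [Fintype ι] (θ : ℝ) (x : ι → ℝ) : ℝ :=
  sSup {y : ℝ | ∃ t : ℝ, 0 < t ∧ y = VTerm θ x t}

/-- the discretization grid `𝕋 = [√(log log m), √(5 log m)] ∩ ℕ`. -/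
def TT (m : ℕ) : Finset ℕ :=
  (Finset.range (m + 1)).filter
    (fun t => Real.sqrt (Real.log (Real.log (m : ℝ))) ≤ (t : ℝ) ∧
      (t : ℝ) ≤ Real.sqrt (5 * Real.log (m : ℝ)))

/-- the discretization grid `𝕋' = [√lo, √(5 log m)] ∩ ℕ` with a general lower endpoint `√lo`. -/
def TTlo (m : ℕ) (lo : ℝ) : Finset ℕ :=
  (Finset.range (m + 1)).filter
    (fun t => Real.sqrt lo ≤ (t : ℝ) ∧ (t : ℝ) ≤ Real.sqrt (5 * Real.log (m : ℝ)))

/-- maximum of `f` over a finite grid (as `sSup` of the image, `= 0` for the empty grid). -/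
def gridMax (S : Finset ℕ) (f : ℝ → ℝ) : ℝ :=
  sSup {y : ℝ | ∃ t ∈ S, y = f (t : ℝ)}

/-- the discretized estimator `π̂*_θ(x; c) = max_{t ∈ 𝕋} [...]`. -/
def piHatStar {ι : Type*} [Fintype ι] (m : ℕ) (θ c : ℝ) (x : ι → ℝ) : ℝ :=
  gridMax (TT m) (piHatTerm θ c x)

/-- the discretized statistic `V*_{n,θ}(x⁰) = max_{t ∈ 𝕋} |...| / Φ̄(t)^θ`. -/
def VstatStar {ι : Type*} [Fintype ι] (m : ℕ) (θ : ℝ) (x : ι → ℝ) : ℝ :=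
  gridMax (TT m) (VTerm θ x)

/-- probability of an event, as a real number. -/
def Pr {Ω : Type*} [MeasureSpace Ω] (A : Set Ω) : ℝ := (volume A).toReal

/-- conditional probability `P(A | E)`, as a real number. -/
def PrCond {Ω : Type*} [MeasureSpace Ω] (E A : Set Ω) : ℝ :=
  ((ProbabilityTheory.cond volume E) A).toReal



lemma PhiBar_eq (t : ℝ) : PhiBar t = (gaussianReal 0 1).real (Set.Ioi t) := by
  have h := probReal_compl_eq_one_sub (μ := gaussianReal 0 1) (measurableSet_Iic (a := t))
  rw [Set.compl_Iic] at h
  rw [h]; rfl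

lemma PhiBar_nonneg (t : ℝ) : 0 ≤ PhiBar t := by
  rw [PhiBar_eq]; exact measureReal_nonneg

lemma gauss_small (v : NNReal) (hv : 3 / 4 ≤ (v : ℝ)) (a b : ℝ) :
    (gaussianReal 0 v) (Set.Ioc a b) ≤ ENNReal.ofReal (b - a) := by
  have hv0 : v ≠ 0 := by
    rintro rfl; norm_num at hv
  rw [gaussianReal_apply _ hv0]
  calc ∫⁻ x in Set.Ioc a b, gaussianPDF 0 v x ≤ ∫⁻ x in Set.Ioc a b, 1 := by
        apply lintegral_mono
        intro x
        show ENNReal.ofReal _ ≤ 1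
        rw [ENNReal.ofReal_le_one, gaussianPDFReal]
        have h1 : (Real.sqrt (2 * Real.pi * v))⁻¹ ≤ 1 := by
          apply inv_le_one_of_one_le₀
          rw [Real.one_le_sqrt]
          nlinarith [Real.pi_gt_three]
        have h2 : Real.exp (-(x - 0) ^ 2 / (2 * v)) ≤ 1 := by
          rw [Real.exp_le_one_iff]
          apply div_nonpos_of_nonpos_of_nonneg
          · nlinarith [sq_nonneg (x - 0)]
          · positivity
        exact mul_le_one₀ h1 (Real.exp_nonneg _) h2
    _ = ENNReal.ofReal (b - a) := by simp

lemma gauss_scale (v : NNReal) (hv : (v : ℝ) ≤ 1) (t : ℝ) (ht : 0 ≤ t) :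
    (gaussianReal 0 v) (Set.Ioi t) ≤ (gaussianReal 0 1) (Set.Ioi t) := by
  have h := gaussianReal_map_const_mul (μ := 0) (v := 1) (Real.sqrt v)
  have h2 : gaussianReal 0 v = Measure.map (fun x => Real.sqrt v * x) (gaussianReal 0 1) := by
    rw [h]
    congr 1
    · simp
    · ext; simp
  rw [h2, Measure.map_apply (by fun_prop) measurableSet_Ioi]
  apply measure_mono
  intro x hx
  simp only [Set.mem_preimage, Set.mem_Ioi] at *
  have h3 : Real.sqrt v ≤ 1 := Real.sqrt_le_one.mpr hv
  have h4 := Real.sqrt_nonneg (v : ℝ)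
  have hx0 : 0 < x := by
    by_contra hc
    push Not at hc
    nlinarith
  nlinarith

lemma pdf_one (x : ℝ) : gaussianPDFReal 0 1 x = stdPhi x := by
  simp [gaussianPDFReal, stdPhi]; ring

lemma mills (t : ℝ) (ht : 0 ≤ t) : stdPhi t ≤ Real.exp 2 * (1 + t) * PhiBar t := by
  have h0 : (0:ℝ) < 1 + t := by linarith
  set h := 1 / (1 + t) with hh
  have hpos : 0 < h := by positivity
  have hle : h ≤ 1 := by rw [hh, div_le_one h0]; linarith
  have hmul : h * (1 + t) = 1 := by rw [hh]; field_simp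
  have key : h * (Real.exp (-2) * stdPhi t) ≤ PhiBar t := by
    have hi : ∫ x in Set.Ioc t (t + h), (Real.exp (-2) * stdPhi t)
        ≤ ∫ x in Set.Ioc t (t + h), gaussianPDFReal 0 1 x := by
      apply setIntegral_mono_on
      · exact integrableOn_const (by simp)
      · exact (integrable_gaussianPDFReal 0 1).integrableOn
      · exact measurableSet_Ioc
      · intro x hx
        rw [pdf_one, stdPhi, stdPhi, ← mul_div_assoc, ← Real.exp_add]
        gcongr
        obtain ⟨hx1, hx2⟩ := hx
        nlinarith [mul_nonneg ht hpos.le]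
    rw [setIntegral_const] at hi
    have h2 : (gaussianReal 0 1).real (Set.Ioc t (t + h))
        = ∫ x in Set.Ioc t (t + h), gaussianPDFReal 0 1 x := by
      rw [Measure.real, gaussianReal_apply_eq_integral _ one_ne_zero, ENNReal.toReal_ofReal]
      exact integral_nonneg (fun x => gaussianPDFReal_nonneg _ _ _)
    have h3 : (gaussianReal 0 1).real (Set.Ioc t (t + h)) ≤ PhiBar t := by
      rw [PhiBar_eq]
      exact measureReal_mono Set.Ioc_subset_Ioi_self
    rw [← h2] at hi
    have h5 : volume.real (Set.Ioc t (t + h)) = h := by simp [hpos.le]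
    rw [h5, smul_eq_mul] at hi
    exact hi.trans h3
  have e2 : Real.exp 2 * Real.exp (-2) = 1 := by rw [← Real.exp_add]; simp
  calc stdPhi t = (Real.exp 2 * Real.exp (-2)) * (h * (1 + t)) * stdPhi t := by
        rw [e2, hmul]; ring
    _ = Real.exp 2 * (1 + t) * (h * (Real.exp (-2) * stdPhi t)) := by ring
    _ ≤ _ := by gcongr

lemma integrable_id_gauss : Integrable (fun x : ℝ => x) (gaussianReal 0 1) := by
  have := memLp_id_gaussianReal (μ := 0) (v := 1) 1
  exact memLp_one_iff_integrable.mp (by rw [ENNReal.coe_one] at this; exact this)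

lemma mean_tail (t : ℝ) : ∫ x in Set.Ioi t, x ∂(gaussianReal 0 1) = stdPhi t := by
  have h1 : ∫ x in Set.Ioi t, x ∂(gaussianReal 0 1) = ∫ x in Set.Ioi t, x * stdPhi x := by
    rw [← integral_indicator measurableSet_Ioi, integral_gaussianReal_eq_integral_smul one_ne_zero,
      ← integral_indicator measurableSet_Ioi]
    congr 1
    ext x
    by_cases hx : x ∈ Set.Ioi t
    · simp only [Set.indicator_of_mem hx, pdf_one, smul_eq_mul]; ring
    · simp [Set.indicator_of_notMem hx]
  have hint : Integrable (fun x : ℝ => x * stdPhi x) := by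
    have := integrable_mul_exp_neg_mul_sq (b := 1 / 2) (by norm_num)
    have := this.div_const (Real.sqrt (2 * Real.pi))
    refine this.congr (Eventually.of_forall fun x => ?_)
    simp only [stdPhi]
    rw [mul_div_assoc]
    congr 3
    ring
  have hder : ∀ x : ℝ, HasDerivAt (fun x => -stdPhi x) (x * stdPhi x) x := by
    intro x
    unfold stdPhi
    have h2 : HasDerivAt (fun x : ℝ => -(x ^ 2) / 2) (-x) x := by
      have := ((hasDerivAt_pow 2 x).neg).div_const 2
      refine this.congr_deriv ?_
      norm_num
      ring
    refine ((h2.exp.div_const (Real.sqrt (2 * Real.pi))).neg).congr_deriv ?_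
    ring
  have hlim : Tendsto (fun x => -stdPhi x) atTop (nhds 0) := by
    have h3 : Tendsto (fun x : ℝ => -(x ^ 2) / 2) atTop atBot := by
      have : Tendsto (fun x : ℝ => x ^ 2 / 2) atTop atTop :=
        (tendsto_pow_atTop two_ne_zero).atTop_div_const (by norm_num)
      refine (tendsto_neg_atTop_atBot.comp this).congr fun x => ?_
      simp [neg_div]
    have := ((Real.tendsto_exp_atBot.comp h3).div_const (Real.sqrt (2 * Real.pi))).neg
    simpa [stdPhi, Function.comp_def] using this
  rw [h1, integral_Ioi_of_hasDerivAt_of_tendsto (hder t).continuousAt.continuousWithinAt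
    (fun x _ => hder x) hint.integrableOn hlim]
  ring

lemma pair_bound {Ω : Type} [MeasureSpace Ω] [IsProbabilityMeasure (volume : Measure Ω)]
    (X Y : Ω → ℝ) (hX : Measurable X) (hY : Measurable Y) (ρ : ℝ) (hρ : |ρ| ≤ 1 / 2)
    (hlin : ∀ a b : ℝ, Measure.map (fun ω => a * X ω + b * Y ω) volume
      = gaussianReal 0 (a ^ 2 + 2 * a * b * ρ + b ^ 2).toNNReal) (t : ℝ) (ht : 0 ≤ t) :
    (volume : Measure Ω).real {ω | t < X ω ∧ t < Y ω}
      ≤ PhiBar t ^ 2 + |ρ| * stdPhi t := by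
  set v : NNReal := (1 - ρ ^ 2).toNNReal with hv
  have hρ2 : ρ ^ 2 ≤ 1 / 4 := by
    rw [← sq_abs]; nlinarith [abs_nonneg ρ]
  have hvr : (v : ℝ) = 1 - ρ ^ 2 := by
    rw [hv, Real.coe_toNNReal _ (by linarith)]
  set W : Ω → ℝ := fun ω => Y ω - ρ * X ω with hW
  have hWm : Measurable W := by fun_prop
  have mX : Measure.map X volume = gaussianReal 0 1 := by
    have := hlin 1 0
    simpa using this
  have mW : Measure.map W volume = gaussianReal 0 v := by
    have := hlin (-ρ) 1
    have e : (fun ω => -ρ * X ω + 1 * Y ω) = W := by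
      ext ω; simp only [hW]; ring
    rw [e] at this
    rw [this, hv]
    congr 2; ring
  have hind : IndepFun X W volume := by
    rw [indepFun_iff_charFun_prod hX.aemeasurable hWm.aemeasurable]
    intro s
    have h1 : charFun (Measure.map (fun ω => WithLp.toLp 2 (X ω, W ω)) volume) s
        = charFun (Measure.map (fun ω => (s.ofLp.1 - ρ * s.ofLp.2) * X ω + s.ofLp.2 * Y ω)
          volume) 1 := by
      rw [charFun_apply, charFun_apply, integral_map, integral_map]
      · congr 1
        ext ω
        congr 3
        simp [WithLp.prod_inner_apply, hW]
        ring
      · fun_prop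
      · fun_prop
      · fun_prop
      · fun_prop
    rw [h1, hlin, mX, mW, charFun_gaussianReal, charFun_gaussianReal, charFun_gaussianReal,
      ← Complex.exp_add, hvr, Real.coe_toNNReal]
    · congr 1
      push_cast
      ring
    · nlinarith [sq_nonneg s.ofLp.1, sq_nonneg s.ofLp.2]
  have hjoint := (indepFun_iff_map_prod_eq_prod_map_map hX.aemeasurable hWm.aemeasurable).mp hind
  rw [mX, mW] at hjoint
  set A : Set (ℝ × ℝ) := {p | t < p.1 ∧ t < ρ * p.1 + p.2} with hA
  have hAm : MeasurableSet A := by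
    apply MeasurableSet.inter
    · exact measurableSet_lt (f := fun _ : ℝ × ℝ => t) (g := fun p : ℝ × ℝ => p.1)
        (by fun_prop) (by fun_prop)
    · exact measurableSet_lt (f := fun _ : ℝ × ℝ => t) (g := fun p : ℝ × ℝ => ρ * p.1 + p.2)
        (by fun_prop) (by fun_prop)
  have hset : {ω | t < X ω ∧ t < Y ω} = (fun ω => (X ω, W ω)) ⁻¹' A := by
    ext ω
    simp [hA, hW]
  set p := PhiBar t with hp
  have hp0 : 0 ≤ p := PhiBar_nonneg t
  have hintg : IntegrableOn (fun x : ℝ => p + |ρ| * x) (Set.Ioi t) (gaussianReal 0 1) :=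
    ((integrable_const p).add (integrable_id_gauss.const_mul |ρ|)).integrableOn
  have hnn : ∀ x ∈ Set.Ioi t, 0 ≤ p + |ρ| * x := by
    intro x hx
    have : 0 ≤ x := ht.trans (le_of_lt hx)
    positivity
  have hbound : volume {ω | t < X ω ∧ t < Y ω}
      ≤ ENNReal.ofReal (∫ x in Set.Ioi t, (p + |ρ| * x) ∂(gaussianReal 0 1)) := by
    rw [hset, ← Measure.map_apply (by fun_prop) hAm, hjoint, Measure.prod_apply hAm,
      ofReal_integral_eq_lintegral_ofReal hintg
        ((ae_restrict_iff' measurableSet_Ioi).mpr (Eventually.of_forall hnn)),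
      ← lintegral_indicator measurableSet_Ioi]
    apply lintegral_mono
    intro x
    by_cases hx : x ∈ Set.Ioi t
    · simp only [Set.indicator_of_mem hx]
      have hx0 : 0 ≤ x := ht.trans (le_of_lt hx)
      have hsub : Prod.mk x ⁻¹' A ⊆ Set.Ioi t ∪ Set.Ioc (t - |ρ| * x) t := by
        intro w hw
        simp only [hA, Set.mem_preimage, Set.mem_ofPred_eq, Set.mem_union, Set.mem_Ioi,
          Set.mem_Ioc] at *
        by_cases hwt : t < w
        · exact Or.inl hwt
        · right
          refine ⟨?_, not_lt.mp hwt⟩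
          nlinarith [le_abs_self ρ]
      calc _ ≤ (gaussianReal 0 v) (Set.Ioi t ∪ Set.Ioc (t - |ρ| * x) t) := measure_mono hsub
        _ ≤ _ := measure_union_le _ _
        _ ≤ ENNReal.ofReal p + ENNReal.ofReal (|ρ| * x) := by
          gcongr
          · refine (gauss_scale v (by rw [hvr]; nlinarith [sq_nonneg ρ]) t ht).trans ?_
            rw [hp, PhiBar_eq, Measure.real, ENNReal.ofReal_toReal (measure_ne_top _ _)]
          · refine (gauss_small v (by rw [hvr]; linarith) _ _).trans ?_
            rw [sub_sub_cancel]
        _ = _ := by rw [ENNReal.ofReal_add hp0 (by positivity)]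
    · have : Prod.mk x ⁻¹' A = ∅ := by
        ext w
        simp only [hA, Set.mem_preimage, Set.mem_ofPred_eq, Set.mem_empty_iff_false, iff_false]
        exact fun h => hx h.1
      simp [this]
  have hval : ∫ x in Set.Ioi t, (p + |ρ| * x) ∂(gaussianReal 0 1) = p ^ 2 + |ρ| * stdPhi t := by
    rw [integral_add (integrable_const p) (integrable_id_gauss.const_mul |ρ|).integrableOn,
      integral_const_mul, mean_tail, setIntegral_const, ← PhiBar_eq, smul_eq_mul, sq]
  rw [hval] at hbound
  refine ENNReal.toReal_le_of_le_ofReal ?_ hbound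
  have : 0 ≤ stdPhi t := by unfold stdPhi; positivity
  positivity

lemma cov_bound {Ω : Type} [MeasureSpace Ω] [IsProbabilityMeasure (volume : Measure Ω)]
    (X Y : Ω → ℝ) (hX : Measurable X) (hY : Measurable Y) (ρ : ℝ)
    (hlin : ∀ a b : ℝ, Measure.map (fun ω => a * X ω + b * Y ω) volume
      = gaussianReal 0 (a ^ 2 + 2 * a * b * ρ + b ^ 2).toNNReal) (t : ℝ) (ht : 0 ≤ t) :
    (volume : Measure Ω).real {ω | t < X ω ∧ t < Y ω} - PhiBar t ^ 2
      ≤ Real.exp 2 * (1 + t) * PhiBar t * |ρ| := by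
  have hp0 := PhiBar_nonneg t
  by_cases hρ : |ρ| ≤ 1 / 2
  · have h1 := pair_bound X Y hX hY ρ hρ hlin t ht
    have h2 := mul_le_mul_of_nonneg_left (mills t ht) (abs_nonneg ρ)
    linarith
  · push Not at hρ
    have h1 : (volume : Measure Ω).real {ω | t < X ω ∧ t < Y ω} ≤ PhiBar t := by
      have mX : Measure.map X volume = gaussianReal 0 1 := by
        have := hlin 1 0
        simpa using this
      rw [PhiBar_eq, ← mX, map_measureReal_apply hX measurableSet_Ioi]
      exact measureReal_mono fun ω hω => hω.1
    have h2 : 2 ≤ Real.exp 2 := by linarith [Real.add_one_le_exp (2:ℝ)]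
    have h3 : 1 ≤ Real.exp 2 * |ρ| := by nlinarith
    have h4 : 1 ≤ (Real.exp 2 * |ρ|) * (1 + t) := by nlinarith
    have h5 := mul_le_mul_of_nonneg_right h4 hp0
    nlinarith [sq_nonneg (PhiBar t)]

lemma lin_law {m : ℕ} (S : Matrix (Fin m) (Fin m) ℝ) (hS : IsCorrMatrix S)
    {Ω : Type} [MeasureSpace Ω] (x0 : Ω → Fin m → ℝ) (h : HasLawGaussian x0 0 S) (i j : Fin m)
    (a b : ℝ) : Measure.map (fun ω => a * x0 ω i + b * x0 ω j) volume
      = gaussianReal 0 (a ^ 2 + 2 * a * b * S i j + b ^ 2).toNNReal := by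
  have hsym : S j i = S i j := by
    have := hS.1.isHermitian.apply i j
    simpa using this
  set c : Fin m → ℝ := fun k => (if k = i then a else 0) + (if k = j then b else 0) with hc
  have key : ∀ g : Fin m → ℝ, ∑ k, c k * g k = a * g i + b * g j := by
    intro g
    simp [hc, add_mul, Finset.sum_add_distrib, ite_mul]
  have hq : ∑ k, ∑ l, c k * S k l * c l = a ^ 2 + 2 * a * b * S i j + b ^ 2 := by
    have e : ∑ k, ∑ l, c k * S k l * c l = ∑ k, c k * ∑ l, c l * S k l := by
      refine Finset.sum_congr rfl fun k _ => ?_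
      rw [Finset.mul_sum]
      exact Finset.sum_congr rfl fun l _ => by ring
    rw [e, key, key (fun l => S i l), key (fun l => S j l)]
    simp only [hS.2, hsym]
    ring
  have := h.2 c
  rw [hq, key] at this
  simp only [key] at this
  simpa using this

lemma second_moment {m : ℕ} (hm : 0 < m) (S : Matrix (Fin m) (Fin m) ℝ) (hS : IsCorrMatrix S)
    {Ω : Type} [MeasureSpace Ω] [IsProbabilityMeasure (volume : Measure Ω)]
    (x0 : Ω → Fin m → ℝ) (h : HasLawGaussian x0 0 S) (t : ℝ) (ht : 0 ≤ t) :
    Integrable (fun ω => ((m : ℝ)⁻¹ * exceedCount (x0 ω) t - PhiBar t) ^ 2) ∧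
    ∫ ω, ((m : ℝ)⁻¹ * exceedCount (x0 ω) t - PhiBar t) ^ 2
      ≤ Real.exp 2 * (1 + t) * PhiBar t * ((m : ℝ)⁻¹ ^ 2 * ∑ i, ∑ j, |S i j|) := by
  set p := PhiBar t with hp
  set f : Fin m → Ω → ℝ := fun i => Set.indicator {ω | t < x0 ω i} 1 with hf
  have hms : ∀ i, MeasurableSet {ω | t < x0 ω i} := fun i =>
    measurableSet_lt measurable_const (h.1 i)
  have hfi : ∀ i, Integrable (f i) := fun i => (integrable_const 1).indicator (hms i)
  have hff : ∀ i j, (fun ω => f i ω * f j ω) =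
      Set.indicator {ω | t < x0 ω i ∧ t < x0 ω j} 1 := by
    intro i j
    ext ω
    by_cases h1 : t < x0 ω i <;> by_cases h2 : t < x0 ω j <;> simp [hf, h1, h2]
  have hffi : ∀ i j, Integrable (fun ω => f i ω * f j ω) := by
    intro i j
    rw [hff]
    exact (integrable_const 1).indicator ((hms i).inter (hms j))
  have hexp : ∀ ω, ((m : ℝ)⁻¹ * exceedCount (x0 ω) t - p) ^ 2
      = (m : ℝ)⁻¹ ^ 2 * ∑ i, ∑ j, (f i ω * f j ω - p * f i ω - p * f j ω + p ^ 2) := by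
    intro ω
    have e1 : exceedCount (x0 ω) t = ∑ i, f i ω := by
      simp [exceedCount, hf, Set.indicator_apply]
    have e2 : (m : ℝ)⁻¹ * exceedCount (x0 ω) t - p = (m : ℝ)⁻¹ * ∑ i, (f i ω - p) := by
      rw [e1, Finset.sum_sub_distrib]
      simp
      field_simp
    rw [e2, mul_pow, sq (∑ i, (f i ω - p)), Finset.sum_mul_sum]
    congr 1
    refine Finset.sum_congr rfl fun i _ => Finset.sum_congr rfl fun j _ => ?_
    ring
  have hterm : ∀ i j, Integrable (fun ω => f i ω * f j ω - p * f i ω - p * f j ω + p ^ 2) :=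
    fun i j => (((hffi i j).sub ((hfi i).const_mul p)).sub ((hfi j).const_mul p)).add
      (integrable_const _)
  have hEf : ∀ i, ∫ ω, f i ω = p := by
    intro i
    simp only [hf]
    rw [integral_indicator_one (hms i), hp, PhiBar_eq]
    have := lin_law S hS x0 h i i 1 0
    simp only [one_mul, zero_mul, add_zero] at this
    norm_num at this
    rw [← this, map_measureReal_apply (h.1 i) measurableSet_Ioi]
    rfl
  have hEt : ∀ i j, ∫ ω, (f i ω * f j ω - p * f i ω - p * f j ω + p ^ 2)
      ≤ Real.exp 2 * (1 + t) * p * |S i j| := by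
    intro i j
    have i1 : Integrable (fun ω => f i ω * f j ω - p * f i ω) :=
      (hffi i j).sub ((hfi i).const_mul p)
    have i2 : Integrable (fun ω => f i ω * f j ω - p * f i ω - p * f j ω) :=
      i1.sub ((hfi j).const_mul p)
    have i3 : ∫ ω, f i ω * f j ω
        = (volume : Measure Ω).real {ω | t < x0 ω i ∧ t < x0 ω j} := by
      rw [hff]
      exact integral_indicator_one ((hms i).inter (hms j))
    rw [integral_add i2 (integrable_const _), integral_sub i1 ((hfi j).const_mul p),
      integral_sub (hffi i j) ((hfi i).const_mul p), integral_const_mul, integral_const_mul,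
      hEf, hEf, i3]
    have := cov_bound (fun ω => x0 ω i) (fun ω => x0 ω j) (h.1 i) (h.1 j) (S i j)
      (lin_law S hS x0 h i j) t ht
    simp only [integral_const, probReal_univ, one_smul]
    linarith
  constructor
  · simp_rw [hexp]
    exact (integrable_finsetSum _ fun i _ => integrable_finsetSum _ fun j _ =>
      hterm i j).const_mul _
  · simp_rw [hexp]
    rw [integral_const_mul, integral_finsetSum _ fun i _ => integrable_finsetSum _ fun j _ =>
      hterm i j]
    have : ∑ i, ∫ ω, ∑ j, (f i ω * f j ω - p * f i ω - p * f j ω + p ^ 2)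
        ≤ ∑ i, ∑ j, Real.exp 2 * (1 + t) * p * |S i j| := by
      refine Finset.sum_le_sum fun i _ => ?_
      rw [integral_finsetSum _ fun j _ => hterm i j]
      exact Finset.sum_le_sum fun j _ => hEt i j
    simp_rw [← Finset.mul_sum] at this
    calc _ ≤ (m : ℝ)⁻¹ ^ 2 * (Real.exp 2 * (1 + t) * p * ∑ i, ∑ j, |S i j|) := by gcongr
      _ = _ := by ring

lemma PhiBar_pos (t : ℝ) (ht : 0 ≤ t) : 0 < PhiBar t := by
  have h := mills t ht
  have h2 : 0 < stdPhi t := by unfold stdPhi; positivity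
  by_contra hc
  have : PhiBar t = 0 := le_antisymm (not_lt.mp hc) (PhiBar_nonneg t)
  rw [this] at h
  linarith

lemma term_bound {m : ℕ} (hm : 0 < m) (S : Matrix (Fin m) (Fin m) ℝ) (hS : IsCorrMatrix S)
    {Ω : Type} [MeasureSpace Ω] [IsProbabilityMeasure (volume : Measure Ω)]
    (x0 : Ω → Fin m → ℝ) (h : HasLawGaussian x0 0 S) (t : ℝ) (ht : 0 ≤ t) (c : ℝ) (hc : 0 < c) :
    c ^ 2 * (volume : Measure Ω).real {ω | c < VTerm 0.5 (x0 ω) t}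
      ≤ Real.exp 2 * (1 + t) * ((m : ℝ)⁻¹ ^ 2 * ∑ i, ∑ j, |S i j|) := by
  obtain ⟨h1, h2⟩ := second_moment hm S hS x0 h t ht
  have hp := PhiBar_pos t ht
  have h3 := mul_meas_ge_le_integral_of_nonneg
    (Eventually.of_forall fun ω => sq_nonneg ((m : ℝ)⁻¹ * exceedCount (x0 ω) t - PhiBar t))
    h1 (c ^ 2 * PhiBar t)
  have hsub : {ω | c < VTerm 0.5 (x0 ω) t} ⊆ {ω | c ^ 2 * PhiBar t ≤
      ((m : ℝ)⁻¹ * exceedCount (x0 ω) t - PhiBar t) ^ 2} := by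
    intro ω hω
    simp only [Set.mem_ofPred_eq, VTerm, Fintype.card_fin] at *
    have e : PhiBar t ^ (0.5 : ℝ) = Real.sqrt (PhiBar t) := by
      rw [Real.sqrt_eq_rpow]; norm_num
    rw [e, lt_div_iff₀ (Real.sqrt_pos.mpr hp)] at hω
    have h4 := pow_le_pow_left₀ (by positivity) hω.le 2
    rwa [mul_pow, Real.sq_sqrt hp.le, sq_abs] at h4
  have h5 := measureReal_mono (μ := (volume : Measure Ω)) hsub
  have h6 := mul_le_mul_of_nonneg_left h5 (by positivity : 0 ≤ c ^ 2 * PhiBar t)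
  have h7 := (h6.trans h3).trans h2
  refine le_of_mul_le_mul_right ?_ hp
  linarith

/-- universal bounding sequence `C_α m⁻¹ √(S log m)` for `θ = 0.5`. -/
theorem stmt4 (α : ℝ) (hα : α ∈ Set.Ioo (0:ℝ) 1) :
    ∃ C : ℝ, ∀ m : ℕ, 3 ≤ m →
      ∀ (S : Matrix (Fin m) (Fin m) ℝ), IsCorrMatrix S →
      ∀ (Ω : Type) [MeasureSpace Ω] [IsProbabilityMeasure (volume : Measure Ω)]
        (x0 : Ω → Fin m → ℝ), HasLawGaussian x0 0 S →
      Pr {ω | C * (m : ℝ)⁻¹ * Real.sqrt ((∑ i, ∑ j, |S i j|) * Real.log m)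
          < VstatStar m 0.5 (x0 ω)} < α := by
  obtain ⟨hα0, hα1⟩ := hα
  set C : ℝ := Real.sqrt (12 * Real.exp 2 / α) with hC
  have hC0 : 0 < C := Real.sqrt_pos.mpr (by positivity)
  have hC2 : C ^ 2 = 12 * Real.exp 2 / α := Real.sq_sqrt (by positivity)
  refine ⟨C, ?_⟩
  intro m hm S hS Ω _ _ x0 h
  have hm0 : 0 < m := by omega
  have hmr : (3:ℝ) ≤ m := by exact_mod_cast hm
  have hL : 1 ≤ Real.log m := by
    rw [Real.le_log_iff_exp_le (by linarith)]
    linarith [Real.exp_one_lt_d9]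
  set L := Real.log m with hLdef
  have hSpos : 0 < ∑ i, ∑ j, |S i j| := by
    refine Finset.sum_pos (fun i _ => ?_) ⟨⟨0, hm0⟩, Finset.mem_univ _⟩
    refine lt_of_lt_of_le one_pos ?_
    have := Finset.single_le_sum (f := fun j => |S i j|) (fun j _ => abs_nonneg _)
      (Finset.mem_univ i)
    simpa [hS.2] using this
  set T := ∑ i, ∑ j, |S i j| with hT
  set c := C * (m : ℝ)⁻¹ * Real.sqrt (T * L) with hc
  have hc0 : 0 < c := by
    have : 0 < Real.sqrt (T * L) := Real.sqrt_pos.mpr (by positivity)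
    positivity
  have hc2 : c ^ 2 = C ^ 2 * L * ((m : ℝ)⁻¹ ^ 2 * T) := by
    rw [hc, mul_pow, mul_pow, Real.sq_sqrt (by positivity : 0 ≤ T * L)]; ring
  have hsub : {ω | c < VstatStar m 0.5 (x0 ω)}
      ⊆ ⋃ t ∈ TT m, {ω | c < VTerm 0.5 (x0 ω) (t : ℝ)} := by
    intro ω hω
    simp only [Set.mem_ofPred_eq, VstatStar, gridMax] at hω
    have hne : {y : ℝ | ∃ t ∈ TT m, y = VTerm 0.5 (x0 ω) (t : ℝ)}.Nonempty := by
      by_contra hcon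
      rw [Set.not_nonempty_iff_eq_empty] at hcon
      rw [hcon, Real.sSup_empty] at hω
      linarith
    obtain ⟨y, ⟨t, ht, rfl⟩, hy⟩ := exists_lt_of_lt_csSup hne hω
    simp only [Set.mem_iUnion]
    exact ⟨t, ht, hy⟩
  set R := Real.sqrt (5 * L) with hR
  have hR2 : R ^ 2 = 5 * L := Real.sq_sqrt (by positivity)
  have hR0 : 0 ≤ R := Real.sqrt_nonneg _
  have hcard : ((TT m).card : ℝ) ≤ 1 + R := by
    have h1 : TT m ⊆ Finset.range (⌊R⌋₊ + 1) := by
      intro t ht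
      simp only [TT, Finset.mem_filter] at ht
      rw [Finset.mem_range, Nat.lt_succ_iff]
      exact Nat.le_floor ht.2.2
    have h2 := Finset.card_le_card h1
    rw [Finset.card_range] at h2
    have h3 : ((TT m).card : ℝ) ≤ (⌊R⌋₊ : ℝ) + 1 := by exact_mod_cast h2
    linarith [Nat.floor_le hR0]
  have hMT : 0 < (m : ℝ)⁻¹ ^ 2 * T := by positivity
  have hP : Pr {ω | c < VstatStar m 0.5 (x0 ω)}
      ≤ ∑ t ∈ TT m, (volume : Measure Ω).real {ω | c < VTerm 0.5 (x0 ω) (t : ℝ)} :=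
    (measureReal_mono hsub (measure_ne_top _ _)).trans (measureReal_biUnion_finset_le _ _)
  have hsum : c ^ 2 * ∑ t ∈ TT m, (volume : Measure Ω).real {ω | c < VTerm 0.5 (x0 ω) (t : ℝ)}
      ≤ (1 + R) * (Real.exp 2 * (1 + R) * ((m : ℝ)⁻¹ ^ 2 * T)) := by
    rw [Finset.mul_sum]
    calc _ ≤ ∑ t ∈ TT m, Real.exp 2 * (1 + R) * ((m : ℝ)⁻¹ ^ 2 * T) := by
          refine Finset.sum_le_sum fun t ht => ?_
          refine (term_bound hm0 S hS x0 h t (Nat.cast_nonneg t) c hc0).trans ?_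
          simp only [TT, Finset.mem_filter] at ht
          have := ht.2.2
          gcongr
      _ = (TT m).card * (Real.exp 2 * (1 + R) * ((m : ℝ)⁻¹ ^ 2 * T)) := by
          rw [Finset.sum_const, nsmul_eq_mul]
      _ ≤ _ := by gcongr
  have hRL : (1 + R) ^ 2 < 12 * L := by
    have : R ≤ 2.3 * L := by
      refine Real.sqrt_le_iff.mpr ⟨by positivity, ?_⟩
      nlinarith
    nlinarith
  have hfin : c ^ 2 * Pr {ω | c < VstatStar m 0.5 (x0 ω)} < c ^ 2 * α := by
    refine lt_of_le_of_lt ((mul_le_mul_of_nonneg_left hP (sq_nonneg c)).trans hsum) ?_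
    have e : c ^ 2 * α = (12 * L) * (Real.exp 2 * ((m : ℝ)⁻¹ ^ 2 * T)) := by
      rw [hc2, hC2]; field_simp
    rw [e]
    have h9 := mul_lt_mul_of_pos_right hRL
      (by positivity : 0 < Real.exp 2 * ((m : ℝ)⁻¹ ^ 2 * T))
    linarith
  exact lt_of_mul_lt_mul_left hfin (sq_nonneg c)

end
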